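/- BCH bound: with the standing setup, let C be a nonzero ideal of 𝓡 = R[X]/⟨X^n−λ⟩, and let g_0(X), …, g_{ℓ−1}(X) be the unique monic generator-polynomial sequence of C (so g_0 ∣ X^n−λ, g_v ∣ g_{v−1}, and C = ⟨g_0 + πg_1 + ⋯ + π^{ℓ−1}g_{ℓ−1}⟩). Let t be the multiplicative order of λ̄ in F^×, let ξ be a primitive tn-th root of unity in an extension field of F with ξ^n = λ̄, and let Q = { j ∈ 1+tℤ_{tn} : ḡ_{ℓ−1}(ξ^j) = 0 } be the residue zero set of C. If Q contains d consecutive points of 1+tℤ_{tn}, i.e. contains 1+tk, 1+t(k+1), …, 1+t(k+d−1) for some k, then every nonzero element of C has Hamming weight at least d+1, i.e. w_H(C) ≥ d+1. -/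

import Mathlib

open Polynomial

/-- The Hamming weight of an element of `S[X]/⟨g⟩` (`g` monic of degree `n`): the number of
nonzero coefficients of its unique representative of degree `< n`. -/
noncomputable def hammingWt {S : Type*} [CommRing S] (g : Polynomial S)
    (c : Polynomial S ⧸ Ideal.span {g}) : ℕ :=
  ((Quotient.out c) %ₘ g).support.card

/-- The BCH bound over a field: a nonzero polynomial of degree less than the order of `α` which
vanishes at `d` consecutive points `a * α ^ i` has more than `d` nonzero coefficients. -/
theorem lt_card_support_of_eval_mul_pow_eq_zero {K : Type*} [Field K] {f : K[X]} (hf : f ≠ 0)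
    {a α : K} (ha : a ≠ 0) (hdeg : f.degree < orderOf α) {d : ℕ}
    (hroots : ∀ i < d, f.eval (a * α ^ i) = 0) : d < f.support.card := by
  by_contra! hle
  have hlt : ∀ m ∈ f.support, m < orderOf α := fun m hm ↦ by
    exact_mod_cast (le_degree_of_mem_supp m hm).trans_lt hdeg
  let e := f.support.equivFin.symm
  have hinj : Function.Injective fun j ↦ α ^ (e j : ℕ) := fun i j hij ↦
    e.injective (Subtype.ext (pow_injOn_Iio_orderOf (hlt _ (e i).2) (hlt _ (e j).2) hij))
  have hv := Matrix.eq_zero_of_forall_pow_sum_mul_pow_eq_zero (R := K)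
    (v := fun j ↦ f.coeff (e j) * a ^ (e j : ℕ)) hinj fun i ↦ by
      rw [← hroots i (i.2.trans_le hle), eval_eq_sum, Polynomial.sum,
        ← Finset.sum_coe_sort f.support, ← e.sum_comp]
      exact Finset.sum_congr rfl fun j _ ↦ by ring
  obtain ⟨m, hm⟩ := nonempty_support_iff.mpr hf
  have h := congrFun hv (f.support.equivFin ⟨m, hm⟩)
  simp only [e, Equiv.symm_apply_apply, Pi.zero_apply, mul_eq_zero] at h
  exact h.elim (mem_support_iff.mp hm) (pow_ne_zero m ha)

theorem isLocalRing_of_ideal_le_total {R : Type*} [CommRing R] [Nontrivial R]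
    (hchain : ∀ I J : Ideal R, I ≤ J ∨ J ≤ I) : IsLocalRing R := by
  refine .of_isUnit_or_isUnit_one_sub_self fun a ↦ ?_
  rcases hchain (Ideal.span {a}) (Ideal.span {1 - a}) with h | h
  · right
    rw [Ideal.span_singleton_le_span_singleton] at h
    exact isUnit_of_dvd_one (by simpa using dvd_add h (dvd_refl (1 - a)))
  · left
    rw [Ideal.span_singleton_le_span_singleton] at h
    exact isUnit_of_dvd_one (by simpa using dvd_add h (dvd_refl a))

/-- A nonzero polynomial over a ring with `π` nilpotent is a multiple, by a nonzero power of `π`,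
of a polynomial not divisible by `π`. -/
theorem exists_eq_C_pow_mul_of_pow_eq_zero {R : Type*} [CommRing R] {π : R} {ℓ : ℕ}
    (hπ : π ^ ℓ = 0) {f : R[X]} (hf : f ≠ 0) :
    ∃ (s : ℕ) (h : R[X]), f = C (π ^ s) * h ∧ π ^ s ≠ 0 ∧ ¬ C π ∣ h := by
  classical
  have hex : ∃ s, ¬ C (π ^ s) ∣ f := ⟨ℓ, by simpa [hπ] using hf⟩
  obtain ⟨s, hs⟩ : ∃ s, Nat.find hex = s + 1 :=
    Nat.exists_eq_succ_of_ne_zero fun h0 ↦ by simp [Nat.find_eq_zero] at h0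
  obtain ⟨h, rfl⟩ := not_not.mp (Nat.find_min hex (m := s) (by lia))
  refine ⟨s, h, rfl, fun h0 ↦ hf (by simp [h0]), fun hdvd ↦ Nat.find_spec hex ?_⟩
  rw [hs, pow_succ, C_mul]
  exact mul_dvd_mul_left _ hdvd

/-- A monic divisor `g` of a constant multiple `C a * h` divides `h` modulo any homomorphism
killing the annihilator of `a`. -/
theorem Polynomial.Monic.map_dvd_map_of_dvd_C_mul {R S : Type*} [CommRing R] [CommRing S]
    {g h : R[X]} (hg : g.Monic) {a : R} (φ : R →+* S) (hφ : ∀ b, a * b = 0 → φ b = 0)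
    (hdvd : g ∣ C a * h) : g.map φ ∣ h.map φ := by
  rw [← modByMonic_eq_zero_iff_dvd (hg.map φ), ← map_modByMonic φ hg]
  rw [← modByMonic_eq_zero_iff_dvd hg, ← smul_eq_C_mul, smul_modByMonic] at hdvd
  ext i
  simpa using hφ _ (by simpa using congrArg (coeff · i) hdvd)

/-- BCH bound.  With the standing setup, let `C` be a nonzero ideal of `𝓡 = R[X]/⟨X^n−λ⟩`
with generator-polynomial sequence `g_0, …, g_{ℓ−1}` (monic, `g_0 ∣ X^n−λ`, `g_v ∣ g_{v−1}`,
`C = ⟨g_0 + πg_1 + ⋯ + π^{ℓ−1}g_{ℓ−1}⟩`).  Let `t` be the order of `λ̄` in `F^×`, `ξ` a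
primitive `tn`-th root of unity in an extension field `E` of `F` with `ξ^n = λ̄`.  If the
residue zero set `Q = {j ∈ 1+tℤ_{tn} : ḡ_{ℓ−1}(ξ^j) = 0}` contains the `d` consecutive
points `1+tk, 1+t(k+1), …, 1+t(k+d−1)`, then every nonzero codeword of `C` has Hamming
weight at least `d+1`. -/
theorem stmt_11 {R : Type*} [CommRing R] [Fintype R]
    (hchain : ∀ I J : Ideal R, I ≤ J ∨ J ≤ I)
    (π : R) (hJ : Ideal.jacobson (⊥ : Ideal R) = Ideal.span {π})
    (ℓ : ℕ) (hℓ : 0 < ℓ) (hnil : π ^ ℓ = 0) (hnil' : π ^ (ℓ - 1) ≠ 0)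
    (p r : ℕ) (hp : p.Prime) (hcard : Nat.card (R ⧸ Ideal.span {π}) = p ^ r)
    (n : ℕ) (hn : 1 < n) (hnp : Nat.Coprime n p)
    (lam : R) (hlam : IsUnit lam)
    (I : Ideal (Polynomial R ⧸ Ideal.span {X ^ n - Polynomial.C lam})) (hI : I ≠ ⊥)
    -- the generator-polynomial sequence of `C`
    (g : Fin ℓ → Polynomial R)
    (hgmonic : ∀ v, (g v).Monic)
    (hg0 : g ⟨0, hℓ⟩ ∣ (X ^ n - Polynomial.C lam))
    (hgdvd : ∀ v : ℕ, ∀ hv : v + 1 < ℓ, g ⟨v + 1, hv⟩ ∣ g ⟨v, Nat.lt_of_succ_lt hv⟩)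
    (hgen : I = Ideal.span {Ideal.Quotient.mk (Ideal.span {X ^ n - Polynomial.C lam})
      (∑ v : Fin ℓ, Polynomial.C (π ^ (v : ℕ)) * g v)})
    -- `t` is the multiplicative order of `λ̄` in the residue field `F`
    (t : ℕ) (ht : t = orderOf (Ideal.Quotient.mk (Ideal.span {π}) lam))
    -- `ξ` is a primitive `tn`-th root of unity with `ξ^n = λ̄` in an extension field `E` of `F`
    {E : Type*} [Field E] (em : (R ⧸ Ideal.span {π}) →+* E)
    (ξ : E) (hξ : orderOf ξ = t * n)
    (hξn : ξ ^ n = em (Ideal.Quotient.mk (Ideal.span {π}) lam))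
    -- the residue zero set of `C` contains `d` consecutive points `1+tk, …, 1+t(k+d−1)`
    (k d : ℕ)
    (hroots : ∀ i < d, Polynomial.eval₂ em (ξ ^ (1 + t * (k + i)))
      ((g ⟨ℓ - 1, Nat.sub_lt hℓ Nat.one_pos⟩).map (Ideal.Quotient.mk (Ideal.span {π}))) = 0) :
    ∀ c ∈ I, c ≠ 0 → d + 1 ≤ hammingWt (X ^ n - Polynomial.C lam) c := by
  intro c hc hc0
  have : Nontrivial R := nontrivial_of_ne _ _ hnil'
  have : IsLocalRing R := isLocalRing_of_ideal_le_total hchain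
  have hmax : IsLocalRing.maximalIdeal R = Ideal.span {π} :=
    (IsLocalRing.jacobson_eq_maximalIdeal ⊥ bot_ne_top).symm.trans hJ
  have hunit : ∀ {a : R}, a ∉ Ideal.span {π} → IsUnit a := fun ha ↦ by
    rwa [← hmax, IsLocalRing.mem_maximalIdeal, mem_nonunits_iff, not_not] at ha
  let φ : R →+* E := em.comp (Ideal.Quotient.mk (Ideal.span {π}))
  have hφ : ∀ {a : R}, a ∈ Ideal.span {π} → φ a = 0 := fun ha ↦ by
    simp [φ, Ideal.Quotient.eq_zero_iff_mem.mpr ha]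
  have hn0 : n ≠ 0 := by omega
  have hPmonic : (X ^ n - C lam).Monic := monic_X_pow_sub_C lam hn0
  let gl := g ⟨ℓ - 1, Nat.sub_lt hℓ Nat.one_pos⟩
  have hdvd_of_le : ∀ m v : ℕ, ∀ hm : m < ℓ, ∀ hvm : v ≤ m,
      g ⟨m, hm⟩ ∣ g ⟨v, hvm.trans_lt hm⟩ := by
    intro m v hm hvm
    induction m, hvm using Nat.le_induction with
    | base => exact dvd_rfl
    | succ m _ ih => exact (hgdvd m hm).trans (ih _)
  have hgl : ∀ v, gl ∣ g v := fun v ↦ hdvd_of_le (ℓ - 1) v _ (by omega)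
  have hglP : gl ∣ X ^ n - C lam := (hgl _).trans hg0
  let f : R[X] := Quotient.out c %ₘ (X ^ n - C lam)
  have hmk : Ideal.Quotient.mk (Ideal.span {X ^ n - C lam}) (Quotient.out c) = c :=
    Quotient.out_eq c
  have hf0 : f ≠ 0 := fun h ↦ hc0 <| by
    rw [← hmk, Ideal.Quotient.eq_zero_iff_mem, Ideal.mem_span_singleton]
    exact (modByMonic_eq_zero_iff_dvd hPmonic).mp h
  have hfdvd : gl ∣ f := by
    rw [hgen, Ideal.mem_span_singleton] at hc
    obtain ⟨q, hq⟩ := hc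
    obtain ⟨q, rfl⟩ := Ideal.Quotient.mk_surjective q
    rw [← hmk, ← map_mul, Ideal.Quotient.mk_eq_mk_iff_sub_mem, Ideal.mem_span_singleton] at hq
    have hG : gl ∣ ∑ v : Fin ℓ, C (π ^ (v : ℕ)) * g v :=
      Finset.dvd_sum fun v _ ↦ (hgl v).mul_left _
    have hout : gl ∣ Quotient.out c := (dvd_iff_dvd_of_dvd_sub (hglP.trans hq)).mpr (hG.mul_right q)
    have hf : f = Quotient.out c - (X ^ n - C lam) * (Quotient.out c /ₘ (X ^ n - C lam)) :=
      modByMonic_eq_sub_mul_div _ _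
    exact hf ▸ dvd_sub hout (hglP.mul_right _)
  obtain ⟨s, h, hfh, hs, hh⟩ := exists_eq_C_pow_mul_of_pow_eq_zero hnil hf0
  have hann : ∀ b, π ^ s * b = 0 → φ b = 0 := fun b hb ↦ hφ <| by
    by_contra hb'
    exact hs ((hunit hb').mul_left_eq_zero.mp hb)
  have hh0 : h.map φ ≠ 0 := by
    rw [C_dvd_iff_dvd_coeff, not_forall] at hh
    obtain ⟨i, hi⟩ := hh
    rw [← Ideal.mem_span_singleton] at hi
    exact fun h0 ↦ ((hunit hi).map φ).ne_zero (by simpa using congrArg (coeff · i) h0)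
  have hsupp : (h.map φ).support ⊆ f.support := fun i hi ↦ by
    rw [mem_support_iff, coeff_map] at hi
    rw [mem_support_iff, hfh, coeff_C_mul]
    exact fun h0 ↦ hi (hann _ h0)
  have ht0 : t ≠ 0 := by
    rw [ht, ← (hlam.map (Ideal.Quotient.mk (Ideal.span {π}))).unit_spec, orderOf_units]
    exact (orderOf_pos _).ne'
  have hξ0 : ξ ≠ 0 := fun h0 ↦ (hlam.map φ).ne_zero (by simpa [φ, h0, hn0] using hξn.symm)
  have hord : orderOf (ξ ^ t) = n := by
    rw [orderOf_pow_of_dvd ht0 (hξ ▸ dvd_mul_right t n), hξ, Nat.mul_div_cancel_left n (by omega)]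
  have hdeg : (h.map φ).degree < orderOf (ξ ^ t) := by
    rw [hord]
    refine (degree_mono hsupp).trans_lt ?_
    simpa only [degree_X_pow_sub_C (Nat.pos_of_ne_zero hn0)] using
      degree_modByMonic_lt (Quotient.out c) hPmonic
  refine (lt_card_support_of_eval_mul_pow_eq_zero hh0 (pow_ne_zero (1 + t * k) hξ0) hdeg
    fun i hi ↦ ?_).trans_le (Finset.card_le_card hsupp)
  refine eval_eq_zero_of_dvd_of_eval_eq_zero
    ((hgmonic _).map_dvd_map_of_dvd_C_mul φ hann (hfh ▸ hfdvd)) ?_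
  have := hroots i hi
  rw [eval₂_eq_eval_map, map_map] at this
  rwa [← pow_mul, ← pow_add, add_assoc, ← mul_add]
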